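/- arXiv:math/0411104 — 2 statements merged into one kernel-verified Lean document; each statement's English description precedes it below -/
import Mathlib

section
/- Every nonzero element x of the module M = F ⊕ F ⊕ M₃(F) ⊕ M₃(F) can be brought to the form (1, β, A, 0) for some β ∈ F and A ∈ M₃(F) by an element of G(M); that is, there exist g ∈ G(M), β ∈ F, and A ∈ M₃(F) with g(x) = (1, β, A, 0). -/
open Matrix

namespace Freudenthal

variable (F : Type*) [Field F]

/-- The cubic Jordan algebra `J = M₃(F)`. -/
abbrev Mat := Matrix (Fin 3) (Fin 3) F

/-- The trace bilinear form `(A, B) = tr(A·B)` on `J`. -/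
def tb (A B : Mat F) : F := (A * B).trace

/-- The Freudenthal cross product `A × B = (A+B)# − A# − B#` (adjoint = adjugate). -/
def cross (A B : Mat F) : Mat F := (A + B).adjugate - A.adjugate - B.adjugate

/-- The Freudenthal module `M = F ⊕ F ⊕ J ⊕ J`, elements `(α, β, A, B)`. -/
abbrev FM := F × F × Mat F × Mat F

/-- The quartic norm `q(x) = 8(A#,B#) − 8α·det A − 8β·det B − 2((A,B) − αβ)²`. -/
def qf (x : FM F) : F :=
  8 * tb F x.2.2.1.adjugate x.2.2.2.adjugate - 8 * x.1 * x.2.2.1.det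
    - 8 * x.2.1 * x.2.2.2.det - 2 * (tb F x.2.2.1 x.2.2.2 - x.1 * x.2.1) ^ 2

/-- The symplectic form `{x, y} = αδ − βγ + (A,D) − (B,C)`. -/
def symp (x y : FM F) : F :=
  x.1 * y.2.1 - x.2.1 * y.1 + tb F x.2.2.1 y.2.2.2 - tb F x.2.2.2 y.2.2.1

/-- Membership in the group `G(M)`: invertible `F`-linear transformations of `M`
preserving the quartic norm `q` and the symplectic form `{·,·}`. -/
def InG (g : FM F → FM F) : Prop :=
  IsLinearMap F g ∧ Function.Bijective g ∧
    (∀ x, qf F (g x) = qf F x) ∧ (∀ x y, symp F (g x) (g y) = symp F x y)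

end Freudenthal

open Freudenthal

namespace Freudenthal

variable {F : Type*} [Field F]

lemma InG.comp {g h : FM F → FM F} (hg : InG F g) (hh : InG F h) : InG F (g ∘ h) := by
  obtain ⟨a, b, c, d⟩ := hg
  obtain ⟨a', b', c', d'⟩ := hh
  refine ⟨⟨fun x y => ?_, fun r x => ?_⟩, b.comp b', fun x => ?_, fun x y => ?_⟩
  · simp [a'.map_add, a.map_add]
  · simp [a'.map_smul, a.map_smul]
  · simp [c, c']
  · simp [d, d']

/-- `y` is in the orbit of `x`. -/
def Orb (x y : FM F) : Prop := ∃ g, InG F g ∧ g x = y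

lemma Orb.trans {x y z : FM F} (h : Orb x y) (k : Orb y z) : Orb x z := by
  obtain ⟨g, hg, rfl⟩ := h
  obtain ⟨h, hh, rfl⟩ := k
  exact ⟨h ∘ g, hh.comp hg, rfl⟩

lemma inG_id : InG F (id : FM F → FM F) :=
  ⟨⟨fun _ _ => rfl, fun _ _ => rfl⟩, Function.bijective_id, fun _ => rfl, fun _ _ => rfl⟩

lemma Orb.rfl' (x : FM F) : Orb x x := ⟨id, inG_id, rfl⟩

/-- the swap -/
def sw (x : FM F) : FM F := (-x.2.1, x.1, -x.2.2.2, x.2.2.1)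

lemma sw_inG : InG F (sw : FM F → FM F) := by
  refine ⟨⟨fun x y => ?_, fun r x => ?_⟩, ?_, fun x => ?_, fun x y => ?_⟩
  · ext <;> simp [sw] <;> ring
  · ext <;> simp [sw]
  · refine Function.bijective_iff_has_inverse.2
      ⟨fun x => (x.2.1, -x.1, x.2.2.2, -x.2.2.1), fun x => ?_, fun x => ?_⟩ <;> simp [sw]
  · obtain ⟨α, β, A, B⟩ := x
    simp only [sw, qf, tb, Matrix.trace_fin_three, Matrix.mul_apply, Fin.sum_univ_three,
      Matrix.det_fin_three, Matrix.adjugate_fin_three]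
    simp
    ring
  · obtain ⟨α, β, A, B⟩ := x
    obtain ⟨γ, δ, C, D⟩ := y
    simp only [sw, symp, tb, Matrix.trace_fin_three, Matrix.mul_apply, Fin.sum_univ_three]
    simp
    ring

/-- scaling -/
def sc (l : F) (x : FM F) : FM F :=
  (l * x.1, l⁻¹ * x.2.1, Matrix.diagonal ![l⁻¹, 1, 1] * x.2.2.1,
    x.2.2.2 * Matrix.diagonal ![l, 1, 1])

lemma diag_mul {l m : F} (h : l * m = 1) :
    (Matrix.diagonal ![l, 1, 1] : Mat F) * Matrix.diagonal ![m, 1, 1] = 1 := by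
  rw [Matrix.diagonal_mul_diagonal, ← Matrix.diagonal_one]
  congr 1
  ext i
  fin_cases i <;> simp [h]

lemma sc_inG {l : F} (hl : l ≠ 0) : InG F (sc l : FM F → FM F) := by
  have h1 := diag_mul (mul_inv_cancel₀ hl)
  have h2 := diag_mul (inv_mul_cancel₀ hl)
  refine ⟨⟨fun x y => ?_, fun r x => ?_⟩, ?_, fun x => ?_, fun x y => ?_⟩
  · simp [sc, mul_add, add_mul]
  · simp [sc]
    constructor <;> ring
  · refine Function.bijective_iff_has_inverse.2
      ⟨sc l⁻¹, fun x => ?_, fun x => ?_⟩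
    · simp [sc, hl, ← mul_assoc, h1]
      simp [mul_assoc, h1]
    · simp [sc, hl, ← mul_assoc, h2]
      simp [mul_assoc, h2]
  · obtain ⟨α, β, A, B⟩ := x
    simp only [sc, qf, tb, Matrix.adjugate_mul_distrib, Matrix.det_mul]
    have e1 : (adjugate A * adjugate (diagonal ![l⁻¹, 1, 1]) *
       (adjugate (diagonal ![l, 1, 1]) * adjugate B)) = adjugate A * adjugate B := by
      rw [mul_assoc, ← mul_assoc (adjugate (diagonal ![l⁻¹, 1, 1])),
        ← Matrix.adjugate_mul_distrib, h1]
      simp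
    have e2 : (diagonal ![l⁻¹, 1, 1] * A * (B * diagonal ![l, 1, 1])).trace = (A * B).trace := by
      rw [Matrix.trace_mul_comm, mul_assoc, ← mul_assoc (diagonal ![l, 1, 1]), h1, one_mul,
        Matrix.trace_mul_comm]
    rw [e1, e2]
    simp [Matrix.det_diagonal, Fin.prod_univ_three]
    field_simp
  · obtain ⟨α, β, A, B⟩ := x
    obtain ⟨γ, δ, C, D⟩ := y
    have e2 (A B : Mat F) :
        (diagonal ![l⁻¹, 1, 1] * A * (B * diagonal ![l, 1, 1])).trace = (A * B).trace := by
      rw [Matrix.trace_mul_comm, mul_assoc, ← mul_assoc (diagonal ![l, 1, 1]), h1, one_mul,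
        Matrix.trace_mul_comm]
    simp only [sc, symp, tb, e2]
    rw [Matrix.trace_mul_comm (B * _), e2, Matrix.trace_mul_comm C]
    field_simp

/-- elementary transvection in the position `(0, 0)` -/
def ph0 (c : F) (x : FM F) : FM F :=
  (x.1 + c * x.2.2.2 0 0, x.2.1, x.2.2.1 + !![c * x.2.1, 0, 0; 0, 0, 0; 0, 0, 0],
    x.2.2.2 + !![0, 0, 0; 0, c * x.2.2.1 2 2, -(c * x.2.2.1 1 2);
      0, -(c * x.2.2.1 2 1), c * x.2.2.1 1 1])

lemma ph0_inG (c : F) : InG F (ph0 c : FM F → FM F) := by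
  have key : ∀ c : F, Function.LeftInverse (ph0 (-c) : FM F → FM F) (ph0 c) := by
    rintro c ⟨α, β, A, B⟩
    refine Prod.ext ?_ (Prod.ext rfl (Prod.ext ?_ ?_))
    · simp [ph0]
    · ext a b
      fin_cases a <;> fin_cases b <;> simp [ph0]
    · ext a b
      fin_cases a <;> fin_cases b <;> simp [ph0]
  refine ⟨⟨fun x y => ?_, fun r x => ?_⟩, ?_, fun x => ?_, fun x y => ?_⟩
  · refine Prod.ext ?_ (Prod.ext rfl (Prod.ext ?_ ?_))
    · simp [ph0]; ring
    · ext a b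
      fin_cases a <;> fin_cases b <;> simp [ph0] <;> ring
    · ext a b
      fin_cases a <;> fin_cases b <;> simp [ph0] <;> ring
  · refine Prod.ext ?_ (Prod.ext rfl (Prod.ext ?_ ?_))
    · simp [ph0]; ring
    · ext a b
      fin_cases a <;> fin_cases b <;> simp [ph0] <;> ring
    · ext a b
      fin_cases a <;> fin_cases b <;> simp [ph0] <;> ring
  · refine Function.bijective_iff_has_inverse.2 ⟨ph0 (-c), key c, ?_⟩
    have := key (-c)
    rwa [neg_neg] at this
  · obtain ⟨α, β, A, B⟩ := x
    simp only [ph0, qf, tb, Matrix.trace_fin_three, Matrix.mul_apply, Fin.sum_univ_three,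
      Matrix.det_fin_three, Matrix.adjugate_fin_three]
    simp
    ring
  · obtain ⟨α, β, A, B⟩ := x
    obtain ⟨γ, δ, C, D⟩ := y
    simp only [ph0, symp, tb, Matrix.trace_fin_three, Matrix.mul_apply, Fin.sum_univ_three]
    simp
    ring

/-- cyclic shift of rows and columns -/
def sh (i j : Fin 3) (x : FM F) : FM F :=
  (x.1, x.2.1, Matrix.of fun a b => x.2.2.1 (a + i) (b + j),
    Matrix.of fun a b => x.2.2.2 (a + j) (b + i))

lemma sh_inG (i j : Fin 3) : InG F (sh i j : FM F → FM F) := by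
  refine ⟨⟨fun x y => rfl, fun r x => rfl⟩, ?_, fun x => ?_, fun x y => ?_⟩
  · refine Function.bijective_iff_has_inverse.2
      ⟨sh (-i) (-j), fun x => ?_, fun x => ?_⟩ <;> simp [sh] <;> rfl
  · obtain ⟨α, β, A, B⟩ := x
    simp only [sh, qf, tb, Matrix.trace_fin_three, Matrix.mul_apply, Fin.sum_univ_three,
      Matrix.det_fin_three, Matrix.adjugate_fin_three]
    fin_cases i <;> fin_cases j <;> simp [Fin.add_def] <;> ring
  · obtain ⟨α, β, A, B⟩ := x
    obtain ⟨γ, δ, C, D⟩ := y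
    simp only [sh, symp, tb, Matrix.trace_fin_three, Matrix.mul_apply, Fin.sum_univ_three]
    fin_cases i <;> fin_cases j <;> simp [Fin.add_def] <;> ring

/-- elementary transvection in the position `(i, j)` -/
def ph (i j : Fin 3) (c : F) : FM F → FM F := sh (-i) (-j) ∘ ph0 c ∘ sh i j

lemma ph_inG (i j : Fin 3) (c : F) : InG F (ph i j c : FM F → FM F) :=
  (sh_inG _ _).comp ((ph0_inG c).comp (sh_inG _ _))

lemma ph_fst (i j : Fin 3) (c : F) (x : FM F) : (ph i j c x).1 = x.1 + c * x.2.2.2 j i := by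
  simp [ph, ph0, sh]

lemma ph_A (i j : Fin 3) (c : F) (x : FM F) (a b : Fin 3) :
    (ph i j c x).2.2.1 a b = x.2.2.1 a b + if i = a ∧ j = b then c * x.2.1 else 0 := by
  have h (u v : Fin 3) : (!![c * x.2.1, 0, 0; 0, 0, 0; 0, 0, 0] : Mat F) u v =
      if u = 0 ∧ v = 0 then c * x.2.1 else 0 := by
    fin_cases u <;> fin_cases v <;> simp
  simp only [ph, ph0, sh, Function.comp, Matrix.of_apply, Matrix.add_apply, h]
  simp [add_neg_eq_zero, eq_comm]

lemma kill (S : Finset (Fin 3 × Fin 3)) (x : FM F) (hx : x.2.1 ≠ 0) :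
    ∃ y, Orb x y ∧ y.2.1 = x.2.1 ∧ ∀ p ∈ S, y.2.2.1 p.1 p.2 = 0 := by
  classical
  induction S using Finset.induction_on with
  | empty => exact ⟨x, .rfl' x, rfl, by simp⟩
  | insert p S hp ih =>
    obtain ⟨y, h1, h2, h3⟩ := ih
    refine ⟨_, h1.trans ⟨ph p.1 p.2 (-(y.2.2.1 p.1 p.2) / x.2.1), ph_inG _ _ _, rfl⟩, h2, ?_⟩
    intro r hr
    by_cases hrp : r = p
    · subst hrp
      simp [ph_A, h2, hx]
    · have hr' : r ∈ S := by simpa [hrp] using hr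
      have : ¬ (p.1 = r.1 ∧ p.2 = r.2) := fun h => hrp (Prod.ext h.1.symm h.2.symm)
      simp [ph_A, this, h3 r hr']

lemma exists_beta (x : FM F) (hx : x ≠ 0) : ∃ y, Orb x y ∧ y.2.1 ≠ 0 := by
  have step : ∀ x : FM F, x.1 ≠ 0 → ∃ y, Orb x y ∧ y.2.1 ≠ 0 :=
    fun x h => ⟨sw x, ⟨sw, sw_inG, rfl⟩, h⟩
  have stepB : ∀ x : FM F, x.2.2.2 ≠ 0 → ∃ y, Orb x y ∧ y.2.1 ≠ 0 := by
    intro x h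
    by_cases h0 : x.1 = 0
    · have : ∃ j i, x.2.2.2 j i ≠ 0 := by
        by_contra! hc
        exact h (by ext j i; exact hc j i)
      obtain ⟨j, i, hji⟩ := this
      obtain ⟨y, hy, hy'⟩ := step (ph i j 1 x) (by simpa [ph_fst, h0] using hji)
      exact ⟨y, Orb.trans ⟨_, ph_inG i j 1, rfl⟩ hy, hy'⟩
    · exact step x h0
  by_cases hB : x.2.2.2 = 0
  · by_cases hA : x.2.2.1 = 0
    · by_cases hb : x.2.1 = 0
      · refine step x fun ha => hx ?_
        exact Prod.ext ha (Prod.ext hb (Prod.ext hA hB))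
      · exact ⟨x, .rfl' x, hb⟩
    · obtain ⟨y, hy, hy'⟩ := stepB (sw x) hA
      exact ⟨y, Orb.trans ⟨_, sw_inG, rfl⟩ hy, hy'⟩
  · exact stepB x hB

end Freudenthal

/-- **Reduction lemma over a field** (char `F ≠ 2, 3`): every nonzero element of
`M = F ⊕ F ⊕ M₃(F) ⊕ M₃(F)` can be brought to the form `(1, β, A, 0)` by an element
of the group `G(M)`. -/
theorem reduction_lemma_field (F : Type*) [Field F] (h2 : (2 : F) ≠ 0) (h3 : (3 : F) ≠ 0)
    (x : FM F) (hx : x ≠ 0) :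
    ∃ (g : FM F → FM F) (β : F) (A : Mat F),
      InG F g ∧ g x = (1, β, A, 0) := by
  obtain ⟨y, hy, hb⟩ := exists_beta x hx
  obtain ⟨z, hz, hzb, hzA⟩ := kill Finset.univ y hb
  have hA : z.2.2.1 = 0 := by
    ext i j
    exact hzA (i, j) (Finset.mem_univ _)
  have hl : (-z.2.1)⁻¹ ≠ 0 := inv_ne_zero (neg_ne_zero.2 (hzb ▸ hb))
  obtain ⟨g, hg, hgx⟩ := ((hy.trans hz).trans ⟨sw, sw_inG, rfl⟩).trans
    ⟨sc (-z.2.1)⁻¹, sc_inG hl, rfl⟩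
  refine ⟨g, _, _, hg, hgx.trans (Prod.ext ?_ (Prod.ext rfl (Prod.ext rfl ?_)))⟩
  · exact inv_mul_cancel₀ (neg_ne_zero.2 (hzb ▸ hb))
  · simp [sc, sw, hA]
end

section
/- The group G_ℤ acts transitively on the set of projective elements of a given norm: if x, y ∈ M_ℤ are projective and q'(x) = q'(y), then there exists g ∈ G_ℤ with g(x) = y. -/
open Matrix

namespace FreudenthalZ

/-- The integral cubic Jordan algebra `J_ℤ = M₃(ℤ)`. -/
abbrev MatZ := Matrix (Fin 3) (Fin 3) ℤ

/-- The trace bilinear form `(A, B) = tr(A·B)`. -/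
def tb (A B : MatZ) : ℤ := (A * B).trace

/-- The Freudenthal cross product `A × B = (A+B)# − A# − B#` (adjoint = adjugate). -/
def cross (A B : MatZ) : MatZ := (A + B).adjugate - A.adjugate - B.adjugate

/-- The integral Freudenthal module `M_ℤ = ℤ ⊕ ℤ ⊕ J_ℤ ⊕ J_ℤ`, elements `(α, β, A, B)`. -/
abbrev MZ := ℤ × ℤ × MatZ × MatZ

/-- The quartic norm `q'(x) = ((A,B) − αβ)² − 4(A#,B#) + 4α·det A + 4β·det B`. -/
def qz (x : MZ) : ℤ :=
  (tb x.2.2.1 x.2.2.2 - x.1 * x.2.1) ^ 2 - 4 * tb x.2.2.1.adjugate x.2.2.2.adjugate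
    + 4 * x.1 * x.2.2.1.det + 4 * x.2.1 * x.2.2.2.det

/-- The symplectic form `{x, y} = αδ − βγ + (A,D) − (B,C)`. -/
def symp (x y : MZ) : ℤ :=
  x.1 * y.2.1 - x.2.1 * y.1 + tb x.2.2.1 y.2.2.2 - tb x.2.2.2 y.2.2.1

/-- Membership in the group `G_ℤ`: `ℤ`-linear automorphisms of `M_ℤ`
preserving the quartic norm `q'` and the symplectic form `{·,·}`. -/
def InG (g : MZ → MZ) : Prop :=
  IsLinearMap ℤ g ∧ Function.Bijective g ∧
    (∀ x, qz (g x) = qz x) ∧ (∀ x y, symp (g x) (g y) = symp x y)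

/-- `x` is projective: some `g ∈ G_ℤ` maps `x` to a diagonal reduced element
`(α, β, diag(a₁,a₂,a₃), 0)` (`α > 0`, `α ∣ β`, `α ∣ aᵢ`) satisfying the three gcd
conditions `gcd(α·aᵢ, α·β, aⱼ·a_k) = 1`. -/
def Projective (x : MZ) : Prop :=
  ∃ g : MZ → MZ, InG g ∧ ∃ α β a₁ a₂ a₃ : ℤ,
    g x = (α, β, Matrix.diagonal ![a₁, a₂, a₃], 0) ∧
    0 < α ∧ α ∣ β ∧ α ∣ a₁ ∧ α ∣ a₂ ∧ α ∣ a₃ ∧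
    Int.gcd (Int.gcd (α * a₁) (α * β)) (a₂ * a₃) = 1 ∧
    Int.gcd (Int.gcd (α * a₂) (α * β)) (a₃ * a₁) = 1 ∧
    Int.gcd (Int.gcd (α * a₃) (α * β)) (a₁ * a₂) = 1

end FreudenthalZ

namespace FreudenthalZ

theorem InG.id' : InG (fun x => x) :=
  ⟨⟨fun _ _ => rfl, fun _ _ => rfl⟩, Function.bijective_id, fun _ => rfl, fun _ _ => rfl⟩

theorem InG.comp' {g h : MZ → MZ} (hg : InG g) (hh : InG h) : InG (fun x => g (h x)) := by
  obtain ⟨a1, a2, a3, a4⟩ := hg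
  obtain ⟨b1, b2, b3, b4⟩ := hh
  refine ⟨⟨fun x y => ?_, fun c x => ?_⟩, a2.comp b2, fun x => ?_, fun x y => ?_⟩
  · rw [b1.map_add, a1.map_add]
  · rw [b1.map_smul, a1.map_smul]
  · rw [a3, b3]
  · rw [a4, b4]

/-- Orbit equivalence. -/
def Rel (x y : MZ) : Prop := ∃ g : MZ → MZ, InG g ∧ g x = y

theorem Rel.refl' (x : MZ) : Rel x x := ⟨_, InG.id', rfl⟩

theorem Rel.trans' {x y z : MZ} (h : Rel x y) (k : Rel y z) : Rel x z := by
  obtain ⟨g, hg, rfl⟩ := h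
  obtain ⟨f, hf, rfl⟩ := k
  exact ⟨_, hf.comp' hg, rfl⟩

theorem Rel.symm' {x y : MZ} (h : Rel x y) : Rel y x := by
  obtain ⟨g, ⟨a1, a2, a3, a4⟩, rfl⟩ := h
  obtain ⟨f, hl, hr⟩ := Function.bijective_iff_has_inverse.1 a2
  refine ⟨f, ⟨⟨fun x y => ?_, fun c x => ?_⟩, ⟨hr.injective, hl.surjective⟩,
    fun x => ?_, fun x y => ?_⟩, hl x⟩
  · apply a2.1; rw [a1.map_add, hr, hr, hr]
  · apply a2.1; rw [a1.map_smul, hr, hr]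
  · rw [← a3, hr]
  · rw [← a4, hr, hr]

theorem Rel.qz_eq {x y : MZ} (h : Rel x y) : qz x = qz y := by
  obtain ⟨g, ⟨a1, a2, a3, a4⟩, rfl⟩ := h
  exact (a3 x).symm

/-- Left and right multiplication. -/
def actT (s s' t t' : MatZ) (x : MZ) : MZ := (x.1, x.2.1, s * x.2.2.1 * t, t' * x.2.2.2 * s')

theorem tb_act {P P' Q Q' : MatZ} (hP : P' * P = 1) (hQ : Q * Q' = 1) (A B : MatZ) :
    tb (P * A * Q) (Q' * B * P') = tb A B := by
  unfold tb
  have : P * A * Q * (Q' * B * P') = P * (A * B) * P' := by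
    calc P * A * Q * (Q' * B * P') = P * A * (Q * Q') * B * P' := by simp only [Matrix.mul_assoc]
      _ = _ := by rw [hQ]; simp only [Matrix.mul_assoc, Matrix.one_mul]
  rw [this, Matrix.trace_mul_comm, ← Matrix.mul_assoc, hP, Matrix.one_mul]

theorem actT_inG {s s' t t' : MatZ} (hs : s * s' = 1) (ht : t * t' = 1)
    (hd : s.det * t.det = 1) : InG (actT s s' t t') := by
  have hs' : s' * s = 1 := mul_eq_one_comm.1 hs
  have ht' : t' * t = 1 := mul_eq_one_comm.1 ht
  have e1 : s.det * s'.det = 1 := by rw [← Matrix.det_mul, hs, Matrix.det_one]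
  have e2 : t.det * t'.det = 1 := by rw [← Matrix.det_mul, ht, Matrix.det_one]
  have hd' : t'.det * s'.det = 1 := by
    linear_combination (-t'.det * s'.det) * hd + t.det * t'.det * e1 + e2
  refine ⟨⟨fun x y => ?_, fun c x => ?_⟩, ?_, fun x => ?_, fun x y => ?_⟩
  · simp [actT, Matrix.mul_add, Matrix.add_mul]
  · simp [actT, -zsmul_eq_mul]
  · refine Function.bijective_iff_has_inverse.2 ⟨actT s' s t' t, fun x => ?_, fun x => ?_⟩
    · have k1 : s' * (s * x.2.2.1 * t) * t' = x.2.2.1 := by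
        calc _ = (s' * s) * x.2.2.1 * (t * t') := by simp only [Matrix.mul_assoc]
          _ = _ := by rw [hs', ht]; simp
      have k2 : t * (t' * x.2.2.2 * s') * s = x.2.2.2 := by
        calc _ = (t * t') * x.2.2.2 * (s' * s) := by simp only [Matrix.mul_assoc]
          _ = _ := by rw [hs', ht]; simp
      simp only [actT, k1, k2]
    · have k1 : s * (s' * x.2.2.1 * t') * t = x.2.2.1 := by
        calc _ = (s * s') * x.2.2.1 * (t' * t) := by simp only [Matrix.mul_assoc]
          _ = _ := by rw [hs, ht']; simp
      have k2 : t' * (t * x.2.2.2 * s) * s' = x.2.2.2 := by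
        calc _ = (t' * t) * x.2.2.2 * (s * s') := by simp only [Matrix.mul_assoc]
          _ = _ := by rw [hs, ht']; simp
      simp only [actT, k1, k2]
  · have k : tb (s * x.2.2.1 * t).adjugate (t' * x.2.2.2 * s').adjugate
        = tb x.2.2.1.adjugate x.2.2.2.adjugate := by
      rw [Matrix.adjugate_mul_distrib, Matrix.adjugate_mul_distrib, Matrix.adjugate_mul_distrib,
        Matrix.adjugate_mul_distrib, ← Matrix.mul_assoc, ← Matrix.mul_assoc]
      apply tb_act
      · rw [← Matrix.adjugate_mul_distrib, ht, Matrix.adjugate_one]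
      · rw [← Matrix.adjugate_mul_distrib, hs', Matrix.adjugate_one]
    simp only [qz, actT, k, tb_act hs' ht, Matrix.det_mul]
    linear_combination 4 * x.1 * x.2.2.1.det * hd + 4 * x.2.1 * x.2.2.2.det * hd'
  · have k : tb (t' * x.2.2.2 * s') (s * y.2.2.1 * t) = tb x.2.2.2 y.2.2.1 := tb_act ht hs' _ _
    simp only [symp, actT, k, tb_act hs' ht]

/-- The duality map. -/
def actJ (x : MZ) : MZ := (-x.2.1, x.1, -x.2.2.2, x.2.2.1)

theorem tb_comm (A B : MatZ) : tb A B = tb B A := Matrix.trace_mul_comm _ _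

theorem actJ_inG : InG actJ := by
  refine ⟨⟨fun x y => ?_, fun c x => ?_⟩, ?_, fun x => ?_, fun x y => ?_⟩
  · simp [actJ, add_comm]
  · simp [actJ]
  · refine Function.bijective_iff_has_inverse.2
      ⟨fun x => (x.2.1, -x.1, x.2.2.2, -x.2.2.1), fun x => ?_, fun x => ?_⟩ <;> simp [actJ]
  · have h1 : (-x.2.2.2).adjugate = x.2.2.2.adjugate := by
      simp [Matrix.adjugate_fin_three]
    have h2 : (-x.2.2.2).det = - x.2.2.2.det := by
      simp [Matrix.det_fin_three]; ring
    have h3 : tb (-x.2.2.2) x.2.2.1 = - tb x.2.2.1 x.2.2.2 := by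
      rw [tb_comm]; simp [tb]
    simp only [qz, actJ, h1, h2, h3, tb_comm x.2.2.2.adjugate]
    ring
  · simp [symp, actJ, tb]
    ring

/-- Translation by `c E₁₁`. -/
def actP (c : ℤ) (x : MZ) : MZ :=
  (x.1, x.2.1 + c * x.2.2.1 0 0,
    x.2.2.1 + !![0, 0, 0; 0, c * x.2.2.2 2 2, - c * x.2.2.2 1 2; 0, - c * x.2.2.2 2 1, c * x.2.2.2 1 1],
    x.2.2.2 + !![c * x.1, 0, 0; 0, 0, 0; 0, 0, 0])

theorem actP_inG (c : ℤ) : InG (actP c) := by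
  refine ⟨⟨fun x y => ?_, fun d x => ?_⟩, ?_, fun x => ?_, fun x y => ?_⟩
  · ext i j
    · simp [actP]
    · simp [actP]; ring
    · fin_cases i <;> fin_cases j <;> simp [actP] <;> ring
    · fin_cases i <;> fin_cases j <;> simp [actP] <;> ring
  · ext i j
    · simp [actP, -zsmul_eq_mul]
    · simp [actP, -zsmul_eq_mul]; ring
    · fin_cases i <;> fin_cases j <;> simp [actP, -zsmul_eq_mul] <;> ring
    · fin_cases i <;> fin_cases j <;> simp [actP, -zsmul_eq_mul] <;> ring
  · refine Function.bijective_iff_has_inverse.2 ⟨actP (-c), fun x => ?_, fun x => ?_⟩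
    · ext i j
      · simp [actP]
      · simp [actP]
      · fin_cases i <;> fin_cases j <;> simp [actP]
      · fin_cases i <;> fin_cases j <;> simp [actP]
    · ext i j
      · simp [actP]
      · simp [actP]
      · fin_cases i <;> fin_cases j <;> simp [actP]
      · fin_cases i <;> fin_cases j <;> simp [actP]
  · obtain ⟨α, β, A, B⟩ := x
    simp [qz, actP, tb, Matrix.det_fin_three, Matrix.adjugate_fin_three, Matrix.trace_fin_three,
      Matrix.mul_apply, Fin.sum_univ_three]
    ring
  · obtain ⟨α, β, A, B⟩ := x
    obtain ⟨γ, δ, C, D⟩ := y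
    simp [symp, actP, tb, Matrix.trace_fin_three, Matrix.mul_apply, Fin.sum_univ_three]
    ring

/-- Diagonal elements. -/
def dg (α β a₁ a₂ a₃ b₁ b₂ b₃ : ℤ) : MZ :=
  (α, β, !![a₁, 0, 0; 0, a₂, 0; 0, 0, a₃], !![b₁, 0, 0; 0, b₂, 0; 0, 0, b₃])

theorem rel_phi (c α β a₁ a₂ a₃ b₁ b₂ b₃ : ℤ) :
    Rel (dg α β a₁ a₂ a₃ b₁ b₂ b₃)
      (dg α (β + c * a₁) a₁ (a₂ + c * b₃) (a₃ + c * b₂) (b₁ + c * α) b₂ b₃) := by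
  refine ⟨_, actP_inG c, ?_⟩
  simp [actP, dg]

theorem rel_J (α β a₁ a₂ a₃ b₁ b₂ b₃ : ℤ) :
    Rel (dg α β a₁ a₂ a₃ b₁ b₂ b₃) (dg (-β) α (-b₁) (-b₂) (-b₃) a₁ a₂ a₃) := by
  refine ⟨_, actJ_inG, ?_⟩
  simp [actJ, dg]

theorem rel_psi (q α β a₁ a₂ a₃ b₁ b₂ b₃ : ℤ) :
    Rel (dg α β a₁ a₂ a₃ b₁ b₂ b₃)
      (dg (α + q * b₁) β (a₁ + q * β) a₂ a₃ b₁ (b₂ + q * a₃) (b₃ + q * a₂)) := by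
  refine (rel_J _ _ _ _ _ _ _ _).trans' ((rel_phi (-q) _ _ _ _ _ _ _ _).trans' ?_)
  have := (rel_J (α + q * b₁) β (a₁ + q * β) a₂ a₃ b₁ (b₂ + q * a₃) (b₃ + q * a₂)).symm'
  convert this using 2 <;> ring

theorem rel_swap12 (α β a₁ a₂ a₃ b₁ b₂ b₃ : ℤ) :
    Rel (dg α β a₁ a₂ a₃ b₁ b₂ b₃) (dg α β a₂ a₁ a₃ b₂ b₁ b₃) := by
  refine ⟨actT !![0,1,0;1,0,0;0,0,1] !![0,1,0;1,0,0;0,0,1] !![0,1,0;1,0,0;0,0,1]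
    !![0,1,0;1,0,0;0,0,1], actT_inG (by decide) (by decide) (by decide), ?_⟩
  simp [actT, dg]

theorem rel_swap23 (α β a₁ a₂ a₃ b₁ b₂ b₃ : ℤ) :
    Rel (dg α β a₁ a₂ a₃ b₁ b₂ b₃) (dg α β a₁ a₃ a₂ b₁ b₃ b₂) := by
  refine ⟨actT !![1,0,0;0,0,1;0,1,0] !![1,0,0;0,0,1;0,1,0] !![1,0,0;0,0,1;0,1,0]
    !![1,0,0;0,0,1;0,1,0], actT_inG (by decide) (by decide) (by decide), ?_⟩
  simp [actT, dg]

/-- Elements `(1, β, diag a, 0)`. -/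
def rd (β a₁ a₂ a₃ : ℤ) : MZ := dg 1 β a₁ a₂ a₃ 0 0 0

theorem rd_move (q β a₁ a₂ a₃ : ℤ) :
    Rel (rd β a₁ a₂ a₃) (rd (β - 2 * q * a₂ * a₃) (a₁ + q * β - q ^ 2 * a₂ * a₃) a₂ a₃) := by
  refine (rel_psi q _ _ _ _ _ _ _ _).trans' ?_
  refine (rel_swap12 _ _ _ _ _ _ _ _).trans' ?_
  refine (rel_phi (-(q * a₃)) _ _ _ _ _ _ _ _).trans' ?_
  refine (rel_swap12 _ _ _ _ _ _ _ _).trans' ?_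
  refine (rel_swap23 _ _ _ _ _ _ _ _).trans' ?_
  refine (rel_swap12 _ _ _ _ _ _ _ _).trans' ?_
  refine (rel_phi (-(q * a₂)) _ _ _ _ _ _ _ _).trans' ?_
  refine (rel_swap12 _ _ _ _ _ _ _ _).trans' ?_
  refine (rel_swap23 _ _ _ _ _ _ _ _).trans' ?_
  convert Rel.refl' _ using 1
  simp only [rd]
  congr 1 <;> ring

theorem rd_snf (β g a b c u v : ℤ) (h : u * a + v * b = 1) :
    Rel (rd β (g * a) (g * b) c) (rd β g (g * a * b) c) := by
  refine ⟨actT !![u, v, 0; -b, a, 0; 0, 0, 1] !![a, -v, 0; b, u, 0; 0, 0, 1]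
    !![1, -(v * b), 0; 1, u * a, 0; 0, 0, 1] !![u * a, v * b, 0; -1, 1, 0; 0, 0, 1],
    actT_inG ?_ ?_ ?_, ?_⟩
  · ext i j
    fin_cases i <;> fin_cases j <;> simp [Matrix.mul_apply, Fin.sum_univ_three] <;>
      first | linear_combination h | ring
  · ext i j
    fin_cases i <;> fin_cases j <;> simp [Matrix.mul_apply, Fin.sum_univ_three] <;>
      first | linear_combination h | ring
  · simp [Matrix.det_fin_three]
    linear_combination (u * a + v * b + 1) * h
  · have : g * a * b = g * a * b * (u * a + v * b) := by rw [h, mul_one]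
    have h2 : g = g * (u * a + v * b) := by rw [h, mul_one]
    simp only [actT, rd, dg, Prod.mk.injEq, true_and]
    constructor
    · ext i j
      fin_cases i <;> fin_cases j <;> simp [Matrix.mul_apply, Fin.sum_univ_three] <;>
        first | linear_combination g * h | linear_combination g * a * b * h | ring
    · ext i j
      fin_cases i <;> fin_cases j <;> simp [Matrix.mul_apply, Fin.sum_univ_three]

theorem rd_gcd (β a b c : ℤ) :
    ∃ g l, g * l = a * b ∧ g ∣ a ∧ g ∣ b ∧ g ∣ l ∧ a ∣ l ∧ b ∣ l ∧
      (∀ d, d ∣ a → d ∣ b → d ∣ g) ∧ Rel (rd β a b c) (rd β g l c) := by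
  obtain ⟨g, a', b', u, v, ha, hb, h⟩ :
      ∃ g a' b' u v : ℤ, a = g * a' ∧ b = g * b' ∧ u * a' + v * b' = 1 := by
    by_cases h0 : a = 0 ∧ b = 0
    · exact ⟨0, 1, 0, 1, 0, by simp [h0], by simp [h0], by simp⟩
    · have hg : (Int.gcd a b : ℤ) ≠ 0 := by
        intro h; apply h0; exact Int.gcd_eq_zero_iff.1 (by exact_mod_cast h)
      obtain ⟨a', ha⟩ := Int.gcd_dvd_left a b
      obtain ⟨b', hb⟩ := Int.gcd_dvd_right a b
      refine ⟨Int.gcd a b, a', b', Int.gcdA a b, Int.gcdB a b, ha, hb, ?_⟩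
      have := Int.gcd_eq_gcd_ab a b
      apply mul_left_cancel₀ hg
      linear_combination (-Int.gcdA a b) * ha - Int.gcdB a b * hb - this
  subst ha hb
  refine ⟨g, g * a' * b', by ring, ⟨a', rfl⟩, ⟨b', rfl⟩, ⟨a' * b', by ring⟩, ⟨b', by ring⟩,
    ⟨a', by ring⟩, ?_, rd_snf _ _ _ _ _ _ _ h⟩
  intro d h1 h2
  have : g = u * (g * a') + v * (g * b') := by linear_combination (-g) * h
  rw [this]
  exact dvd_add (h1.mul_left _) (h2.mul_left _)

theorem rd_swap12 (β a b c : ℤ) : Rel (rd β a b c) (rd β b a c) := rel_swap12 _ _ _ _ _ _ _ _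
theorem rd_swap23 (β a b c : ℤ) : Rel (rd β a b c) (rd β a c b) := rel_swap23 _ _ _ _ _ _ _ _

theorem rd_cop (β a b c : ℤ) (h : IsCoprime a b) : Rel (rd β a b c) (rd β 1 (a * b) c) := by
  obtain ⟨u, v, h⟩ := h
  simpa using rd_snf β 1 a b c u v h

/-- Step with divisibility chain: `a ∣ b ∣ c`, `β` coprime to `b`. -/
theorem rd_step (β a b c : ℤ) (hbc : b ∣ c) (h : IsCoprime β b) :
    Rel (rd β a b c) (rd (β - 2 * a * b) 1 a (b * (c + β - a * b))) := by
  refine (rd_swap23 _ _ _ _).trans' ((rd_swap12 _ _ _ _).trans' ((rd_move 1 _ _ _ _).trans' ?_))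
  refine (rd_swap23 _ _ _ _).trans' ?_
  have hc : IsCoprime (c + 1 * β - 1 ^ 2 * a * b) b := by
    obtain ⟨k, rfl⟩ := hbc
    have := h.add_mul_left_left (k - a)
    have e : b * k + 1 * β - 1 ^ 2 * a * b = β + b * (k - a) := by ring
    rw [e]; exact this
  refine (rd_cop _ _ _ _ hc).trans' ?_
  refine (rd_swap23 _ _ _ _).trans' ?_
  convert Rel.refl' _ using 2 <;> ring

theorem rd_chain (β a b c : ℤ) (hab : a ∣ b) (hbc : b ∣ c) (h : IsCoprime β b) :
    ∃ γ m, Rel (rd β a b c) (rd γ 1 1 m) := by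
  refine ⟨_, _, (rd_step β a b c hbc h).trans' (rd_step _ 1 a _ (hab.mul_right _) ?_)⟩
  have h1 : IsCoprime β a := h.of_isCoprime_of_dvd_right hab
  have := h1.add_mul_left_left (-2 * b)
  have e : β - 2 * a * b = β + a * (-2 * b) := by ring
  rw [e]; exact this

theorem rd_normal (β m : ℤ) : ∃ n, Rel (rd β 1 1 m) (rd (β % 2) 1 1 n) := by
  refine ⟨m + β / 2 * β - (β / 2) ^ 2 * 1 * 1, (rd_swap23 _ _ _ _).trans' ((rd_swap12 _ _ _ _).trans'
    ((rd_move (β / 2) _ _ _ _).trans' ((rd_swap12 _ _ _ _).trans' ?_)))⟩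
  refine (rd_swap23 _ _ _ _).trans' ?_
  convert Rel.refl' _ using 2
  have := Int.emod_add_mul_ediv β 2
  linarith

theorem rd_qz (β a b c : ℤ) : qz (rd β a b c) = β ^ 2 + 4 * (a * b * c) := by
  simp [qz, rd, dg, tb, Matrix.det_fin_three, Matrix.adjugate_fin_three, Matrix.trace_fin_three]

theorem rd_reduce (β a b c : ℤ)
    (h : ∀ p : ℤ, Prime p → p ∣ β → p ∣ a * b → p ∣ b * c → p ∣ a * c → False) :
    ∃ γ m, Rel (rd β a b c) (rd γ 1 1 m) := by
  -- pass to the elementary divisors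
  obtain ⟨g, l, e1, ga, gb, gl, al, bl, hg, r1⟩ := rd_gcd β a b c
  obtain ⟨g', l', e2, ga', gb', gl', al', bl', hg', r2⟩ := rd_gcd β g c l
  obtain ⟨g'', l'', e3, ga'', gb'', gl'', al'', bl'', hg'', r3⟩ := rd_gcd β l l' g'
  have r : Rel (rd β a b c) (rd β g' g'' l'') :=
    r1.trans' ((rd_swap23 _ _ _ _).trans' (r2.trans' ((rd_swap12 _ _ _ _).trans'
      ((rd_swap23 _ _ _ _).trans' ((rd_swap12 _ _ _ _).trans'
        (r3.trans' ((rd_swap23 _ _ _ _).trans' (rd_swap12 _ _ _ _))))))))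
  have k1 : g' ∣ g'' := hg'' _ (ga'.trans gl) gl'
  have key : ∀ p : ℤ, Prime p → p ∣ β → ¬ p ∣ g'' := by
    intro p hp h1 h2
    have hl : p ∣ l := h2.trans ga''
    have hl' : p ∣ g * c := by rw [← e2]; exact (h2.trans gb'').mul_left _
    refine h p hp h1 ?_ (hl'.trans (mul_dvd_mul_right gb c)) (hl'.trans (mul_dvd_mul_right ga c))
    rw [← e1]; exact hl.mul_left _
  have hcop : IsCoprime β g'' := by
    apply isCoprime_of_prime_dvd
    · rintro ⟨z1, z2⟩
      exact key 2 Int.prime_two (by simp [z1]) (by simp [z2])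
    · exact key
  obtain ⟨γ, m, r'⟩ := rd_chain β g' g'' l'' k1 gl'' hcop
  exact ⟨γ, m, r.trans' r'⟩

theorem projective_normal {x : MZ} (hx : Projective x) :
    ∃ β m : ℤ, Rel x (rd (β % 2) 1 1 m) := by
  obtain ⟨g, hg, α, β, a, b, c, e, h0, dβ, da, db, dc, g1, g2, g3⟩ := hx
  have big : ∀ (d u v w : ℤ), Int.gcd (Int.gcd u v) w = 1 → d ∣ u → d ∣ v → d ∣ w → d ∣ 1 := by
    intro d u v w h hu hv hw
    have := Int.dvd_coe_gcd (Int.dvd_coe_gcd hu hv) hw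
    rw [h] at this
    exact_mod_cast this
  have hα : α = 1 := by
    have := big α _ _ _ g1 (dvd_mul_right _ _) (dvd_mul_right _ _) (db.mul_right _)
    exact Int.eq_one_of_dvd_one h0.le this
  subst hα
  simp only [one_mul] at g1 g2 g3
  have e' : g x = rd β a b c := by
    rw [e]
    simp only [rd, dg, Prod.mk.injEq, true_and]
    constructor <;> ext i j <;> fin_cases i <;> fin_cases j <;> simp
  obtain ⟨γ, m, r⟩ := rd_reduce β a b c (by
    intro p hp hβ hab hbc hac
    rcases hp.dvd_or_dvd hab with h | h
    · exact hp.not_dvd_one (big p _ _ _ g1 h hβ hbc)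
    · exact hp.not_dvd_one (big p _ _ _ g2 h hβ (by rwa [mul_comm])))
  obtain ⟨n, r'⟩ := rd_normal γ m
  exact ⟨γ, n, Rel.trans' ⟨g, hg, e'⟩ (r.trans' r')⟩

end FreudenthalZ

open FreudenthalZ

/-- **Transitivity of `G_ℤ` on projective elements of a given norm**: if `x, y ∈ M_ℤ`
are projective and `q'(x) = q'(y)`, then some `g ∈ G_ℤ` maps `x` to `y`. -/
theorem transitive_on_projective (x y : MZ)
    (hx : Projective x) (hy : Projective y) (hq : qz x = qz y) :
    ∃ g : MZ → MZ, InG g ∧ g x = y := by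
  obtain ⟨β, m, r⟩ := projective_normal hx
  obtain ⟨γ, n, s⟩ := projective_normal hy
  have h := r.qz_eq
  rw [hq, s.qz_eq, rd_qz, rd_qz] at h
  have e : β % 2 = γ % 2 ∧ m = n := by
    rcases Int.emod_two_eq_zero_or_one β with h1 | h1 <;>
    rcases Int.emod_two_eq_zero_or_one γ with h2 | h2 <;> rw [h1, h2] at h ⊢ <;> omega
  rw [e.1, e.2] at r
  exact r.trans' s.symm'
end
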